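/- arXiv:2008.03712 — 6 statements merged into one kernel-verified Lean document; each statement's English description precedes it below -/
import Mathlib

section
/- Let p₁,…,p_k be probability densities with respect to ν on X such that pᵢ·log pᵢ is ν-integrable for each i and p̄·log p̄ is ν-integrable, where p̄ = (1/k)·Σᵢ pᵢ. Let f*ᵢ(x) = pᵢ(x)/Σⱼ pⱼ(x) on {Σⱼ pⱼ > 0} (and 1/k elsewhere). Then the minimal cross-entropy loss satisfies (1/k)·Σᵢ ∫ −pᵢ·log f*ᵢ dν = log k − JS_{(1/k,…,1/k)}(p₁,…,p_k). In particular, minimizing the intervention (cross-entropy) loss over classifiers is equivalent to the equal-weight multi-distribution Jensen–Shannon divergence of p₁,…,p_k up to the additive constant log k. -/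
open MeasureTheory

/-- Entropy `H(p) = −∫ p·log p dν` of a density `p` (convention `0·log 0 = 0`,
which agrees with Lean's `Real.log 0 = 0`). -/
noncomputable def dEntropy {X : Type*} [MeasurableSpace X] (ν : Measure X)
    (p : X → ℝ) : ℝ :=
  -∫ x, p x * Real.log (p x) ∂ν

theorem mul_log_eq_mul_inv_mul_log_add {c : ℝ} (hc : c ≠ 0) (s : ℝ) :
    s * Real.log s = c * (c⁻¹ * s * Real.log (c⁻¹ * s)) + Real.log c * s := by
  rcases eq_or_ne s 0 with rfl | hs
  · simp
  · rw [Real.log_mul (inv_ne_zero hc) hs, Real.log_inv]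
    field_simp
    ring

theorem neg_mul_log_posterior {ι : Type*} [Fintype ι] {q : ι → ℝ} (hq : ∀ j, 0 ≤ q j)
    (i : ι) (c : ℝ) :
    -(q i * Real.log (if 0 < ∑ j, q j then q i / ∑ j, q j else c)) =
      q i * Real.log (∑ j, q j) - q i * Real.log (q i) := by
  rcases (hq i).eq_or_lt with h | h
  · simp [← h]
  · have hS : 0 < ∑ j, q j :=
      h.trans_le (Finset.single_le_sum (fun j _ => hq j) (Finset.mem_univ i))
    rw [if_pos hS, Real.log_div h.ne' hS.ne']
    ring

/-- **Optimal classifier** (part 2 of Theorem 1): the minimal cross-entropy loss,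
attained by the posterior classifier `f*ᵢ = pᵢ / Σⱼ pⱼ`, equals
`log k − JS_{(1/k,…,1/k)}(p₁,…,p_k)`, where the equal-weight multi-distribution
Jensen–Shannon divergence is `H(p̄) − (1/k)·Σᵢ H(pᵢ)` with `p̄ = (1/k)·Σᵢ pᵢ`. -/
theorem min_cross_entropy_eq_log_k_sub_multiJS
    {X : Type*} [MeasurableSpace X] (ν : Measure X) [SigmaFinite ν]
    (k : ℕ) (hk : 0 < k) (p : Fin k → X → ℝ)
    (hp_meas : ∀ i, Measurable (p i)) (hp_nonneg : ∀ i x, 0 ≤ p i x)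
    (hp_int : ∀ i, ∫ x, p i x ∂ν = 1)
    (hp_ent : ∀ i, Integrable (fun x => p i x * Real.log (p i x)) ν)
    (pbar : X → ℝ) (hpbar : pbar = fun x => (k : ℝ)⁻¹ * ∑ i, p i x)
    (hpbar_ent : Integrable (fun x => pbar x * Real.log (pbar x)) ν)
    (fstar : X → Fin k → ℝ)
    (hfstar : fstar = fun x i =>
      if 0 < ∑ j, p j x then p i x / ∑ j, p j x else 1 / k) :
    (k : ℝ)⁻¹ * ∑ i, ∫ x, -(p i x * Real.log (fstar x i)) ∂ν =
      Real.log k - (dEntropy ν pbar - (k : ℝ)⁻¹ * ∑ i, dEntropy ν (p i)) := by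
  have hk_pos : (0 : ℝ) < k := by exact_mod_cast hk
  have hp_integrable : ∀ i, Integrable (p i) ν := fun i =>
    .of_integral_ne_zero (by simp [hp_int i])
  have hS_int : Integrable (fun x => ∑ j, p j x) ν :=
    integrable_finsetSum _ fun i _ => hp_integrable i
  have hS_integral : ∫ x, ∑ j, p j x ∂ν = k := by
    rw [integral_finsetSum _ fun i _ => hp_integrable i]
    simp [hp_int]
  have hS_meas : Measurable fun x => ∑ j, p j x :=
    Finset.measurable_fun_sum _ fun i _ => hp_meas i
  have hS_log : (fun x => (∑ j, p j x) * Real.log (∑ j, p j x)) =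
      fun x => k * (pbar x * Real.log (pbar x)) + Real.log k * ∑ j, p j x := by
    subst hpbar
    funext x
    exact mul_log_eq_mul_inv_mul_log_add hk_pos.ne' _
  have hS_ent : Integrable (fun x => (∑ j, p j x) * Real.log (∑ j, p j x)) ν := by
    rw [hS_log]
    exact (hpbar_ent.const_mul _).add (hS_int.const_mul _)
  have hS_ent_integral : ∫ x, (∑ j, p j x) * Real.log (∑ j, p j x) ∂ν =
      k * ∫ x, pbar x * Real.log (pbar x) ∂ν + Real.log k * k := by
    rw [hS_log, integral_add (hpbar_ent.const_mul _) (hS_int.const_mul _),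
      integral_const_mul, integral_const_mul, hS_integral]
  have h_cross : ∀ i, Integrable (fun x => p i x * Real.log (∑ j, p j x)) ν := fun i => by
    refine hS_ent.mono ((hp_meas i).mul hS_meas.log).aestronglyMeasurable (.of_forall fun x => ?_)
    have hle : p i x ≤ ∑ j, p j x :=
      Finset.single_le_sum (fun j _ => hp_nonneg j x) (Finset.mem_univ i)
    rw [norm_mul, norm_mul, Real.norm_of_nonneg (hp_nonneg i x),
      Real.norm_of_nonneg ((hp_nonneg i x).trans hle)]
    gcongr
  have h_loss : ∀ i, ∫ x, -(p i x * Real.log (fstar x i)) ∂ν =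
      ∫ x, p i x * Real.log (∑ j, p j x) ∂ν + dEntropy ν (p i) := fun i => by
    rw [dEntropy, ← sub_eq_add_neg, ← integral_sub (h_cross i) (hp_ent i)]
    congr 1 with x
    rw [hfstar]
    exact neg_mul_log_posterior (fun j => hp_nonneg j x) i _
  have h_sum : ∑ i, ∫ x, p i x * Real.log (∑ j, p j x) ∂ν =
      ∫ x, (∑ j, p j x) * Real.log (∑ j, p j x) ∂ν := by
    rw [← integral_finsetSum _ fun i _ => h_cross i]
    simp only [Finset.sum_mul]
  simp only [h_loss, Finset.sum_add_distrib]
  rw [h_sum, hS_ent_integral, dEntropy]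
  field_simp
  ring
end

section
/- Let p₁,…,p_k be probability densities with respect to ν on X such that pᵢ·log pᵢ is ν-integrable for each i and p̄·log p̄ is ν-integrable, where p̄ = (1/k)·Σᵢ pᵢ. Then JS_{(1/k,…,1/k)}(p₁,…,p_k) = log k if and only if the densities have pairwise disjoint supports up to null sets, i.e., pᵢ·pⱼ = 0 ν-almost everywhere for all i ≠ j. -/
open MeasureTheory

theorem mul_log_le_mul_log_sum {ι : Type*} [Fintype ι] {a : ι → ℝ} (ha : ∀ i, 0 ≤ a i) (i : ι) :
    a i * Real.log (a i) ≤ a i * Real.log (∑ j, a j) := by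
  rcases (ha i).eq_or_lt with h | h
  · simp [← h]
  · exact mul_le_mul_of_nonneg_left
      (Real.log_le_log h (Finset.single_le_sum (fun j _ => ha j) (Finset.mem_univ i))) (ha i)

theorem sum_mul_log_le_sum_mul_log_sum {ι : Type*} [Fintype ι] {a : ι → ℝ} (ha : ∀ i, 0 ≤ a i) :
    ∑ i, a i * Real.log (a i) ≤ (∑ i, a i) * Real.log (∑ i, a i) := by
  rw [Finset.sum_mul]
  exact Finset.sum_le_sum fun i _ => mul_log_le_mul_log_sum ha i

/-- Equality in the superadditivity of `x ↦ x * log x` means that at most one summand is nonzero. -/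
theorem sum_mul_log_eq_iff {ι : Type*} [Fintype ι] {a : ι → ℝ} (ha : ∀ i, 0 ≤ a i) :
    ∑ i, a i * Real.log (a i) = (∑ i, a i) * Real.log (∑ i, a i) ↔
      ∀ i j, i ≠ j → a i * a j = 0 := by
  classical
  rw [Finset.sum_mul, Finset.sum_eq_sum_iff_of_le fun i _ => mul_log_le_mul_log_sum ha i]
  constructor
  · intro h i j hij
    by_contra hne
    have hi : 0 < a i := (ha i).lt_of_ne' (left_ne_zero_of_mul hne)
    have hj : 0 < a j := (ha j).lt_of_ne' (right_ne_zero_of_mul hne)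
    have hle : a i + a j ≤ ∑ l, a l := by
      rw [← Finset.sum_pair hij]
      exact Finset.sum_le_sum_of_subset_of_nonneg (Finset.subset_univ _) fun l _ _ => ha l
    have hlog := Real.log_lt_log hi (show a i < ∑ l, a l by linarith)
    exact hlog.ne (mul_left_cancel₀ hi.ne' (h i (Finset.mem_univ i)))
  · intro h i _
    by_cases hi : a i = 0
    · simp [hi]
    · rw [Fintype.sum_eq_single i fun j hj => (mul_eq_zero.mp (h i j hj.symm)).resolve_left hi]

theorem mul_log_eq_of_inv_mul {c : ℝ} (hc : c ≠ 0) (s : ℝ) :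
    s * Real.log s = c * (c⁻¹ * s * Real.log (c⁻¹ * s)) + s * Real.log c := by
  by_cases hs : s = 0
  · simp [hs]
  · rw [Real.log_mul (inv_ne_zero hc) hs, Real.log_inv]
    field_simp
    ring

/-- The equal-weight multi-distribution Jensen–Shannon divergence
`JS_{(1/k,…,1/k)}(p₁,…,p_k) = H(p̄) − (1/k)·Σᵢ H(pᵢ)`, with `p̄ = (1/k)·Σᵢ pᵢ`,
attains its maximal value `log k` if and only if the densities have pairwise
disjoint supports up to null sets, i.e. `pᵢ·pⱼ = 0` ν-a.e. for all `i ≠ j`. -/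
theorem multiJS_eq_log_k_iff_disjoint_supports
    {X : Type*} [MeasurableSpace X] (ν : Measure X) [SigmaFinite ν]
    (k : ℕ) (hk : 0 < k) (p : Fin k → X → ℝ)
    (hp_meas : ∀ i, Measurable (p i)) (hp_nonneg : ∀ i x, 0 ≤ p i x)
    (hp_int : ∀ i, ∫ x, p i x ∂ν = 1)
    (hp_ent : ∀ i, Integrable (fun x => p i x * Real.log (p i x)) ν)
    (pbar : X → ℝ) (hpbar : pbar = fun x => (k : ℝ)⁻¹ * ∑ i, p i x)
    (hpbar_ent : Integrable (fun x => pbar x * Real.log (pbar x)) ν) :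
    dEntropy ν pbar - (k : ℝ)⁻¹ * ∑ i, dEntropy ν (p i) = Real.log k ↔
      ∀ i j, i ≠ j → (fun x => p i x * p j x) =ᵐ[ν] 0 := by
  have hk0 : (k : ℝ) ≠ 0 := by positivity
  have hp_integrable : ∀ i, Integrable (p i) ν := fun i =>
    Integrable.of_integral_ne_zero (by simp [hp_int i])
  have hsum_int : Integrable (fun x => ∑ i, p i x) ν :=
    integrable_finsetSum _ fun i _ => hp_integrable i
  have hent_int : Integrable (fun x => ∑ i, p i x * Real.log (p i x)) ν :=
    integrable_finsetSum _ fun i _ => hp_ent i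
  have hlog : (fun x => (∑ i, p i x) * Real.log (∑ i, p i x)) = fun x =>
      k * (pbar x * Real.log (pbar x)) + (∑ i, p i x) * Real.log k := by
    funext x
    rw [hpbar]
    exact mul_log_eq_of_inv_mul hk0 _
  have hlog_int : Integrable (fun x => (∑ i, p i x) * Real.log (∑ i, p i x)) ν := by
    rw [hlog]
    exact (hpbar_ent.const_mul _).add (hsum_int.mul_const _)
  have hlog_integral : ∫ x, (∑ i, p i x) * Real.log (∑ i, p i x) ∂ν =
      k * ∫ x, pbar x * Real.log (pbar x) ∂ν + k * Real.log k := by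
    rw [hlog, integral_add (hpbar_ent.const_mul _) (hsum_int.mul_const _), integral_const_mul,
      integral_mul_const, integral_finsetSum _ fun i _ => hp_integrable i]
    simp [hp_int]
  have hJS : dEntropy ν pbar - (k : ℝ)⁻¹ * ∑ i, dEntropy ν (p i) = Real.log k ↔
      ∫ x, ∑ i, p i x * Real.log (p i x) ∂ν =
        ∫ x, (∑ i, p i x) * Real.log (∑ i, p i x) ∂ν := by
    rw [hlog_integral, integral_finsetSum _ fun i _ => hp_ent i]
    simp only [dEntropy, Finset.sum_neg_distrib]
    rw [← mul_right_inj' hk0, mul_sub, mul_inv_cancel_left₀ hk0]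
    constructor <;> intro h <;> linarith
  rw [hJS, integral_eq_iff_of_ae_le hent_int hlog_int
    (.of_forall fun x => sum_mul_log_le_sum_mul_log_sum fun i => hp_nonneg i x)]
  simp only [Filter.EventuallyEq, sum_mul_log_eq_iff fun i => hp_nonneg i _, ae_all_iff,
    Pi.zero_apply]
end

section
/- Let a ∈ [0,1]. Let p be the uniform probability density (w.r.t. Lebesgue measure on ℝ²) on the square α = [−1/2, 1/2] × [−1/2, 1/2] and q the uniform probability density on the square β = [a−1/2, a+1/2] × [1/2, 3/2]. Then the Jensen–Shannon divergence between p and q equals log 2; in particular it is constant in a. -/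
open MeasureTheory

/-- Entropy `H(p) = −∫ p·log p dμ` of a probability density on `ℝ²` w.r.t. the
Lebesgue measure (convention `0·log 0 = 0`, agreeing with `Real.log 0 = 0`). -/
noncomputable def dEntropy2 (p : ℝ × ℝ → ℝ) : ℝ :=
  -∫ x, p x * Real.log (p x)

/-- The uniform probability density `(1/μ(S))·𝟙_S` on a set `S ⊆ ℝ²`. -/
noncomputable def unifDensity (S : Set (ℝ × ℝ)) : ℝ × ℝ → ℝ :=
  S.indicator fun _ => ((volume S).toReal)⁻¹

theorem integral_unifDensity {S : Set (ℝ × ℝ)} (hS : MeasurableSet S)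
    (h0 : volume S ≠ 0) (htop : volume S ≠ ⊤) : ∫ x, unifDensity S x = 1 := by
  rw [unifDensity, integral_indicator hS, setIntegral_const, smul_eq_mul, Measure.real]
  exact mul_inv_cancel₀ (ENNReal.toReal_ne_zero.mpr ⟨h0, htop⟩)

theorem integrable_unifDensity {S : Set (ℝ × ℝ)} (hS : MeasurableSet S)
    (htop : volume S ≠ ⊤) : Integrable (unifDensity S) :=
  (integrable_indicator_iff hS).mpr (integrableOn_const htop)

theorem unifDensity_mul_log (S : Set (ℝ × ℝ)) (x : ℝ × ℝ) :
    unifDensity S x * Real.log (unifDensity S x) =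
      Real.log (volume S).toReal⁻¹ * unifDensity S x := by
  by_cases hx : x ∈ S <;> simp [unifDensity, hx, mul_comm]

theorem integrable_unifDensity_mul_log {S : Set (ℝ × ℝ)} (hS : MeasurableSet S)
    (htop : volume S ≠ ⊤) :
    Integrable fun x => unifDensity S x * Real.log (unifDensity S x) := by
  simp_rw [unifDensity_mul_log]
  exact (integrable_unifDensity hS htop).const_mul _

theorem half_mul_log_half (u : ℝ) :
    u / 2 * Real.log (u / 2) = u * Real.log u / 2 - Real.log 2 / 2 * u := by
  rcases eq_or_ne u 0 with rfl | hu
  · simp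
  · rw [Real.log_div hu two_ne_zero]
    ring

/-- The Jensen–Shannon divergence of the uniform densities on two almost everywhere disjoint sets
of finite positive measure is `log 2`. -/
theorem JS_unifDensity_of_aedisjoint {S T : Set (ℝ × ℝ)} (hS : MeasurableSet S)
    (hT : MeasurableSet T) (hS0 : volume S ≠ 0) (hT0 : volume T ≠ 0)
    (hStop : volume S ≠ ⊤) (hTtop : volume T ≠ ⊤) (hST : AEDisjoint volume S T) :
    dEntropy2 (fun x => (unifDensity S x + unifDensity T x) / 2) -
      (dEntropy2 (unifDensity S) + dEntropy2 (unifDensity T)) / 2 = Real.log 2 := by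
  have hae : (fun x => (unifDensity S x + unifDensity T x) / 2 *
        Real.log ((unifDensity S x + unifDensity T x) / 2)) =ᵐ[volume]
      fun x => (unifDensity S x * Real.log (unifDensity S x) +
        unifDensity T x * Real.log (unifDensity T x)) / 2 -
        Real.log 2 / 2 * (unifDensity S x + unifDensity T x) := by
    filter_upwards [measure_eq_zero_iff_ae_notMem.mp hST] with x hx
    rw [half_mul_log_half]
    by_cases hxS : x ∈ S
    · have hxT : unifDensity T x = 0 :=
        Set.indicator_of_notMem (fun h => hx ⟨hxS, h⟩) _
      simp [hxT]
    · have hxS' : unifDensity S x = 0 := Set.indicator_of_notMem hxS _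
      simp [hxS']
  have hlS := integrable_unifDensity_mul_log hS hStop
  have hlT := integrable_unifDensity_mul_log hT hTtop
  have hiS := integrable_unifDensity hS hStop
  have hiT := integrable_unifDensity hT hTtop
  have hl : Integrable fun x => (unifDensity S x * Real.log (unifDensity S x) +
      unifDensity T x * Real.log (unifDensity T x)) / 2 := (hlS.add hlT).div_const 2
  have hi : Integrable fun x => Real.log 2 / 2 * (unifDensity S x + unifDensity T x) :=
    (hiS.add hiT).const_mul _
  unfold dEntropy2
  rw [integral_congr_ae hae, integral_sub hl hi,
    integral_div, integral_add hlS hlT, integral_const_mul, integral_add hiS hiT,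
    integral_unifDensity hS hS0 hStop, integral_unifDensity hT hT0 hTtop]
  ring

/-- **Example 1 (square fitting), first computation**: for any offset `a ∈ [0,1]`,
the Jensen–Shannon divergence `JS(p,q) = H((p+q)/2) − (H(p)+H(q))/2` between the
uniform densities on the squares `α = [−1/2,1/2] × [−1/2,1/2]` and
`β = [a−1/2, a+1/2] × [1/2, 3/2]` equals `log 2`; in particular it is constant
in `a`. -/
theorem JS_of_disjoint_squares_constant (a : ℝ) (ha : a ∈ Set.Icc (0 : ℝ) 1)
    (p q : ℝ × ℝ → ℝ)
    (hp : p = unifDensity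
      (Set.Icc (-(1/2) : ℝ) (1/2) ×ˢ Set.Icc (-(1/2) : ℝ) (1/2)))
    (hq : q = unifDensity
      (Set.Icc (a - 1/2) (a + 1/2) ×ˢ Set.Icc (1/2 : ℝ) (3/2))) :
    dEntropy2 (fun x => (p x + q x) / 2) - (dEntropy2 p + dEntropy2 q) / 2 =
      Real.log 2 := by
  subst hp hq
  have hvol (b c d e : ℝ) : volume (Set.Icc b c ×ˢ Set.Icc d e) =
      ENNReal.ofReal (c - b) * ENNReal.ofReal (e - d) := by
    rw [Measure.volume_eq_prod, Measure.prod_prod, Real.volume_Icc, Real.volume_Icc]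
  have hα : volume (Set.Icc (-(1/2) : ℝ) (1/2) ×ˢ Set.Icc (-(1/2) : ℝ) (1/2)) = 1 := by
    rw [hvol]
    norm_num
  have hβ : volume (Set.Icc (a - 1/2) (a + 1/2) ×ˢ Set.Icc (1/2 : ℝ) (3/2)) = 1 := by
    rw [hvol, show a + 1/2 - (a - 1/2) = 1 by ring]
    norm_num
  refine JS_unifDensity_of_aedisjoint (measurableSet_Icc.prod measurableSet_Icc)
    (measurableSet_Icc.prod measurableSet_Icc) (hα ▸ one_ne_zero) (hβ ▸ one_ne_zero)
    (hα ▸ ENNReal.one_ne_top) (hβ ▸ ENNReal.one_ne_top) ?_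
  rw [AEDisjoint, Set.prod_inter_prod, Set.Icc_inter_Icc, Set.Icc_inter_Icc, hvol]
  norm_num
end

section
/- Let a ∈ [0,1]. Consider the uniform probability densities (w.r.t. Lebesgue measure on ℝ²) on the four unit squares α = [−1/2,1/2] × [−1/2,1/2], β = [a−1/2, a+1/2] × [1/2, 3/2], γ₁ = [−1/2,1/2] × [1/2,3/2], and γ₂ = [a−1/2, a+1/2] × [−1/2,1/2]. Then the equal-weight multi-distribution Jensen–Shannon divergence of these four densities (with weights 1/4 each) equals (1 + a)·log 2. In particular it is a non-constant affine function of a, attaining log 2 at a = 0 and log 4 at a = 1. -/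
open MeasureTheory

/-- The integral over the plane of a constant supported on a rectangle. -/
lemma integral_indicator_rectangle {a b c d : ℝ} (hab : a ≤ b) (hcd : c ≤ d) (k : ℝ) :
    ∫ x, (Set.Icc a b ×ˢ Set.Icc c d).indicator (fun _ : ℝ × ℝ => k) x =
      (b - a) * (d - c) * k := by
  rw [integral_indicator_const _ (measurableSet_Icc.prod measurableSet_Icc), measureReal_def,
    Measure.volume_eq_prod, Measure.prod_prod, ENNReal.toReal_mul, Real.volume_Icc,
    Real.volume_Icc, ENNReal.toReal_ofReal (sub_nonneg.2 hab),
    ENNReal.toReal_ofReal (sub_nonneg.2 hcd), smul_eq_mul]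

/-- The uniform density on a rectangle of unit area is its indicator function. -/
lemma unifDensity_rectangle_of_area_eq_one {a b c d : ℝ} (hab : a ≤ b) (hcd : c ≤ d)
    (h : (b - a) * (d - c) = 1) :
    unifDensity (Set.Icc a b ×ˢ Set.Icc c d) =
      (Set.Icc a b ×ˢ Set.Icc c d).indicator fun _ => 1 := by
  rw [unifDensity, Measure.volume_eq_prod, Measure.prod_prod, ENNReal.toReal_mul,
    Real.volume_Icc, Real.volume_Icc, ENNReal.toReal_ofReal (sub_nonneg.2 hab),
    ENNReal.toReal_ofReal (sub_nonneg.2 hcd), h, inv_one]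

/-- An indicator function has zero entropy. -/
lemma dEntropy2_indicator_one (S : Set (ℝ × ℝ)) :
    dEntropy2 (S.indicator fun _ => 1) = 0 := by
  have h (x : ℝ × ℝ) : S.indicator (fun _ => (1 : ℝ)) x *
      Real.log (S.indicator (fun _ => (1 : ℝ)) x) = 0 := by
    by_cases hx : x ∈ S <;> simp [hx]
  simp [dEntropy2, h]

/-- A horizontal line in the plane is Lebesgue-null. -/
lemma ae_snd_ne (c : ℝ) : ∀ᵐ x : ℝ × ℝ, x.2 ≠ c := by
  rw [Measure.volume_eq_prod]
  exact Measure.quasiMeasurePreserving_snd.ae (Measure.ae_ne volume c)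

/-- **Example 1 (square fitting), intervention loss**: for any offset `a ∈ [0,1]`,
the equal-weight multi-distribution Jensen–Shannon divergence
`JS = H((p₀+p₁+p₂+p₃)/4) − (H(p₀)+H(p₁)+H(p₂)+H(p₃))/4` of the uniform densities
on the four unit squares `α = [−1/2,1/2]×[−1/2,1/2]`, `β = [a−1/2,a+1/2]×[1/2,3/2]`,
`γ₁ = [−1/2,1/2]×[1/2,3/2]`, `γ₂ = [a−1/2,a+1/2]×[−1/2,1/2]` equals `(1+a)·log 2`:
a non-constant affine function of `a`, equal to `log 2` at `a = 0` and `log 4` at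
`a = 1`. -/
theorem multiJS_of_four_squares (a : ℝ) (ha : a ∈ Set.Icc (0 : ℝ) 1)
    (p₀ p₁ p₂ p₃ : ℝ × ℝ → ℝ)
    (hp₀ : p₀ = unifDensity
      (Set.Icc (-(1/2) : ℝ) (1/2) ×ˢ Set.Icc (-(1/2) : ℝ) (1/2)))
    (hp₁ : p₁ = unifDensity
      (Set.Icc (a - 1/2) (a + 1/2) ×ˢ Set.Icc (1/2 : ℝ) (3/2)))
    (hp₂ : p₂ = unifDensity
      (Set.Icc (-(1/2) : ℝ) (1/2) ×ˢ Set.Icc (1/2 : ℝ) (3/2)))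
    (hp₃ : p₃ = unifDensity
      (Set.Icc (a - 1/2) (a + 1/2) ×ˢ Set.Icc (-(1/2) : ℝ) (1/2))) :
    dEntropy2 (fun x => (p₀ x + p₁ x + p₂ x + p₃ x) / 4) -
        (dEntropy2 p₀ + dEntropy2 p₁ + dEntropy2 p₂ + dEntropy2 p₃) / 4 =
      (1 + a) * Real.log 2 := by
  obtain ⟨ha₀, ha₁⟩ := ha
  rw [unifDensity_rectangle_of_area_eq_one (by linarith) (by linarith) (by ring)]
    at hp₀ hp₁ hp₂ hp₃
  have hquarter : Real.log (1 / 4) = -(2 * Real.log 2) := by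
    rw [one_div, Real.log_inv, show (4 : ℝ) = 2 ^ 2 by norm_num, Real.log_pow]
    norm_num
  have hhalf : Real.log (1 / 2) = -Real.log 2 := by rw [one_div, Real.log_inv]
  have hmix : dEntropy2 (fun x => (p₀ x + p₁ x + p₂ x + p₃ x) / 4) =
      (1 + a) * Real.log 2 := by
    have hae : (fun x => (p₀ x + p₁ x + p₂ x + p₃ x) / 4 *
          Real.log ((p₀ x + p₁ x + p₂ x + p₃ x) / 4)) =ᵐ[volume]
        (Set.Icc (-(1 / 2)) (a + 1 / 2) ×ˢ Set.Icc (-(1 / 2)) (3 / 2)).indicator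
          fun _ => -(Real.log 2 / 2) := by
      filter_upwards [ae_snd_ne (1 / 2)] with ⟨u, v⟩ hv
      simp only [hp₀, hp₁, hp₂, hp₃, Set.indicator_apply, Set.mem_prod, Set.mem_Icc]
      have hv' : v < 1 / 2 ∨ 1 / 2 < v := lt_or_gt_of_ne hv
      have e₁ : ((1 : ℝ) + 1) / 4 = 1 / 2 := by norm_num
      split_ifs <;> first
        | (exfalso; grind)
        | (simp only [add_zero, zero_add, e₁, hquarter, hhalf, zero_div, zero_mul]; try ring)
    rw [dEntropy2, integral_congr_ae hae,
      integral_indicator_rectangle (by linarith) (by norm_num)]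
    ring
  rw [hmix, hp₀, hp₁, hp₂, hp₃]
  simp only [dEntropy2_indicator_one]
  ring
end

section
/- Let X, X′, Y, Y′ be random vectors with values in ℝ^d on a common probability space such that ‖X − X′‖_∞ and ‖Y − Y′‖_∞ are integrable, and let δ > 0. For a random vector Z write F_Z(r) = P(∀j, Zⱼ ≤ rⱼ) and osc_Z(r, δ) = F_Z(r + δ𝟙) − F_Z(r − δ𝟙), where 𝟙 = (1,…,1). Then for every r ∈ ℝ^d: |F_X(r) − F_Y(r)| ≤ (E[‖X − X′‖_∞] + E[‖Y − Y′‖_∞])/δ + sup_{s ∈ ℝ^d} |F_{X′}(s) − F_{Y′}(s)| + osc_{X′}(r, δ) + osc_{Y′}(r, δ). -/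
open MeasureTheory

/-- Multivariate CDF of a random vector `Z` in `ℝ^d`:
`F_Z(r) = P(∀ j, Zⱼ ≤ rⱼ)`, as a real number. -/
noncomputable def mcdf {Ω : Type*} [MeasurableSpace Ω] (μ : Measure Ω) {d : ℕ}
    (Z : Ω → Fin d → ℝ) (r : Fin d → ℝ) : ℝ :=
  (μ {ω | ∀ j, Z ω j ≤ r j}).toReal

/-- Oscillation of the multivariate CDF: `osc_Z(r,δ) = F_Z(r+δ𝟙) − F_Z(r−δ𝟙)`. -/
noncomputable def mcdfOsc {Ω : Type*} [MeasurableSpace Ω] (μ : Measure Ω) {d : ℕ}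
    (Z : Ω → Fin d → ℝ) (r : Fin d → ℝ) (δ : ℝ) : ℝ :=
  mcdf μ Z (fun j => r j + δ) - mcdf μ Z (fun j => r j - δ)

lemma mcdf_mono {Ω : Type*} [MeasurableSpace Ω] (μ : Measure Ω) [IsFiniteMeasure μ] {d : ℕ}
    (Z : Ω → Fin d → ℝ) : Monotone (mcdf μ Z) := fun _ _ h =>
  measureReal_mono fun _ hω j => (hω j).trans (h j)

lemma mcdf_le_mcdf_add {Ω : Type*} [MeasurableSpace Ω] (μ : Measure Ω) [IsFiniteMeasure μ]
    {d : ℕ} {Z W : Ω → Fin d → ℝ} (hZW : Integrable (fun ω => ‖Z ω - W ω‖) μ)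
    {δ : ℝ} (hδ : 0 < δ) (r : Fin d → ℝ) :
    mcdf μ Z r ≤ mcdf μ W (fun j => r j + δ) + (∫ ω, ‖Z ω - W ω‖ ∂μ) / δ := by
  have markov : μ.real {ω | δ ≤ ‖Z ω - W ω‖} ≤ (∫ ω, ‖Z ω - W ω‖ ∂μ) / δ := by
    rw [le_div_iff₀' hδ]
    exact mul_meas_ge_le_integral_of_nonneg (ae_of_all _ fun _ => norm_nonneg _) hZW δ
  have hsub : {ω | ∀ j, Z ω j ≤ r j} ⊆
      {ω | ∀ j, W ω j ≤ r j + δ} ∪ {ω | δ ≤ ‖Z ω - W ω‖} := by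
    intro ω hω
    by_cases h : δ ≤ ‖Z ω - W ω‖
    · exact Or.inr h
    · refine Or.inl fun j => ?_
      have hj : |Z ω j - W ω j| ≤ ‖Z ω - W ω‖ := norm_le_pi_norm (Z ω - W ω) j
      have hω' : Z ω j ≤ r j := hω j
      linarith [neg_abs_le (Z ω j - W ω j)]
  calc mcdf μ Z r ≤ μ.real ({ω | ∀ j, W ω j ≤ r j + δ} ∪ {ω | δ ≤ ‖Z ω - W ω‖}) :=
        measureReal_mono hsub
    _ ≤ μ.real {ω | ∀ j, W ω j ≤ r j + δ} + μ.real {ω | δ ≤ ‖Z ω - W ω‖} :=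
        measureReal_union_le _ _
    _ ≤ _ := add_le_add_right markov _

lemma mcdf_sub_le_mcdf_add {Ω : Type*} [MeasurableSpace Ω] (μ : Measure Ω) [IsFiniteMeasure μ]
    {d : ℕ} {Z W : Ω → Fin d → ℝ} (hZW : Integrable (fun ω => ‖Z ω - W ω‖) μ)
    {δ : ℝ} (hδ : 0 < δ) (r : Fin d → ℝ) :
    mcdf μ W (fun j => r j - δ) ≤ mcdf μ Z r + (∫ ω, ‖Z ω - W ω‖ ∂μ) / δ := by
  simp only [norm_sub_rev (Z _)] at hZW ⊢
  simpa using mcdf_le_mcdf_add μ hZW hδ fun j => r j - δ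

lemma bddAbove_range_abs_mcdf_sub {Ω : Type*} [MeasurableSpace Ω] (μ : Measure Ω)
    [IsProbabilityMeasure μ] {d : ℕ} (Z W : Ω → Fin d → ℝ) :
    BddAbove (Set.range fun s => |mcdf μ Z s - mcdf μ W s|) := by
  refine ⟨1, ?_⟩
  rintro _ ⟨s, rfl⟩
  exact abs_sub_le_of_nonneg_of_le measureReal_nonneg measureReal_le_one
    measureReal_nonneg measureReal_le_one

/-- Quantitative core of Theorem 2 (Inverse Distribution), abstract form: for
random vectors `X, X′, Y, Y′` in `ℝ^d` with `‖X − X′‖_∞`, `‖Y − Y′‖_∞` integrable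
and any `δ > 0`, `r ∈ ℝ^d`,
`|F_X(r) − F_Y(r)| ≤ (E‖X − X′‖_∞ + E‖Y − Y′‖_∞)/δ + sup_s |F_{X′}(s) − F_{Y′}(s)|
  + osc_{X′}(r,δ) + osc_{Y′}(r,δ)`.
(The norm on `Fin d → ℝ` is the sup-norm.) -/
theorem cdf_difference_bound
    {Ω : Type*} [MeasurableSpace Ω] (μ : Measure Ω) [IsProbabilityMeasure μ]
    (d : ℕ) (X X' Y Y' : Ω → Fin d → ℝ)
    (hX : Measurable X) (hX' : Measurable X')
    (hY : Measurable Y) (hY' : Measurable Y')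
    (hXX' : Integrable (fun ω => ‖X ω - X' ω‖) μ)
    (hYY' : Integrable (fun ω => ‖Y ω - Y' ω‖) μ)
    (δ : ℝ) (hδ : 0 < δ) (r : Fin d → ℝ) :
    |mcdf μ X r - mcdf μ Y r| ≤
      ((∫ ω, ‖X ω - X' ω‖ ∂μ) + ∫ ω, ‖Y ω - Y' ω‖ ∂μ) / δ +
        (⨆ s : Fin d → ℝ, |mcdf μ X' s - mcdf μ Y' s|) +
        mcdfOsc μ X' r δ + mcdfOsc μ Y' r δ := by
  have hsup : |mcdf μ X' r - mcdf μ Y' r| ≤ ⨆ s : Fin d → ℝ, |mcdf μ X' s - mcdf μ Y' s| :=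
    le_ciSup (bddAbove_range_abs_mcdf_sub μ X' Y') r
  have hle : r ≤ fun j => r j + δ := fun j => le_add_of_nonneg_right hδ.le
  have hge : (fun j => r j - δ) ≤ r := fun j => sub_le_self _ hδ.le
  have := mcdf_mono μ X' hle
  have := mcdf_mono μ X' hge
  have := mcdf_mono μ Y' hle
  have := mcdf_mono μ Y' hge
  have := mcdf_le_mcdf_add μ hXX' hδ r
  have := mcdf_sub_le_mcdf_add μ hXX' hδ r
  have := mcdf_le_mcdf_add μ hYY' hδ r
  have := mcdf_sub_le_mcdf_add μ hYY' hδ r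
  obtain ⟨_, _⟩ := abs_le.mp hsup
  rw [add_div, mcdfOsc, mcdfOsc, abs_le]
  constructor <;> linarith
end

section
/- Let k, m ≥ 1, let γ denote the standard Gaussian measure on ℝ^m, and let Γ denote the k-fold product measure of γ on the space (Fin k → ℝ^m) (i.e., the standard Gaussian on ℝ^{km}). For each i ∈ Fin k, let Tᵢ : (Fin k → ℝ^m) × ℝ^m → (Fin k → ℝ^m) be the block-substitution map Tᵢ(x, z) = Function.update x i z (replace the i-th block of x by z). Suppose μ is a probability measure on (Fin k → ℝ^m) such that for every i, the pushforward of the product measure μ ⊗ γ under Tᵢ equals μ. Then μ = Γ. -/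
open MeasureTheory ProbabilityTheory

/-- A probability measure on a finite product that is invariant under resampling each coordinate
`i` independently from `ν i` is the product measure of the `ν i`. -/
theorem MeasureTheory.Measure.eq_pi_of_map_update_prod_eq {ι : Type*} [Fintype ι] [DecidableEq ι]
    {α : ι → Type*} [∀ i, MeasurableSpace (α i)] (ν : ∀ i, Measure (α i)) [∀ i, SigmaFinite (ν i)]
    (μ : Measure (∀ i, α i)) [IsProbabilityMeasure μ]
    (h : ∀ i, (μ.prod (ν i)).map (fun p => Function.update p.1 i p.2) = μ) :
    μ = Measure.pi ν := by
  refine (Measure.pi_eq fun s hs => ?_).symm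
  suffices H : ∀ F : Finset ι, μ ((F : Set ι).pi s) = ∏ i ∈ F, ν i (s i) by
    simpa using H Finset.univ
  intro F
  induction F using Finset.induction_on with
  | empty => simp
  | insert a F ha ih =>
    have h_meas : Measurable fun p : (∀ i, α i) × α a => Function.update p.1 a p.2 :=
      measurable_update'
    have h_pre : (fun p : (∀ i, α i) × α a => Function.update p.1 a p.2) ⁻¹'
        ((insert a F : Finset ι) : Set ι).pi s = (F : Set ι).pi s ×ˢ s a := by
      ext ⟨x, z⟩
      have h_off : (∀ i ∈ F, Function.update x a z i ∈ s i) ↔ ∀ i ∈ F, x i ∈ s i :=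
        forall₂_congr fun i hi => by
          rw [Function.update_of_ne (ne_of_mem_of_not_mem hi ha)]
      simp [Set.mem_pi, h_off, and_comm]
    conv_lhs => rw [← h a]
    rw [Measure.map_apply h_meas (.pi (Finset.countable_toSet _) fun i _ => hs i), h_pre,
      Measure.prod_prod, ih, Finset.prod_insert ha, mul_comm]

/-- **Block substitution is a complete intervention group for the standard
Gaussian prior.** Let `γ` be the standard Gaussian on `ℝ^m` and `Γ` the `k`-fold
product of `γ` (the standard Gaussian on `ℝ^{km}`, whose points are `k`-tuples of
blocks in `ℝ^m`). The block-substitution map `Tᵢ(x,z) = Function.update x i z`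
replaces the `i`-th block of `x` by `z`. If a probability measure `μ` on
`ℝ^{km}` is invariant under every block substitution with fresh `γ`-noise, i.e.
the pushforward of `μ ⊗ γ` under `Tᵢ` equals `μ` for every `i`, then `μ = Γ`. -/
theorem block_substitution_interventions_complete
    (k m : ℕ) (hk : 0 < k) (hm : 0 < m)
    (γ : Measure (Fin m → ℝ))
    (hγ : γ = Measure.pi fun _ : Fin m => gaussianReal 0 1)
    (μ : Measure (Fin k → Fin m → ℝ)) [IsProbabilityMeasure μ]
    (hinv : ∀ i : Fin k,
      Measure.map
        (fun p : (Fin k → Fin m → ℝ) × (Fin m → ℝ) =>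
          Function.update p.1 i p.2)
        (μ.prod γ) = μ) :
    μ = Measure.pi fun _ : Fin k => γ := by
  subst hγ
  exact Measure.eq_pi_of_map_update_prod_eq _ μ hinv
end
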